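/- On ℝ³ ∖ {0} with spherical coordinates (r, Ω), suppose c₁, c₂ > 0. Then the Riemannian metric (dr²/r² + dΩ²)/(c₁|ln r| + c₂)² is complete. -/

import Mathlib

open Manifold Set Filter Topology MeasureTheory

noncomputable section

variable {E : Type*} [NormedAddCommGroup E] [NormedSpace ℝ E]
  {H : Type*} [TopologicalSpace H] {I : ModelWithCorners ℝ E H}
  {M : Type*} [TopologicalSpace M] [ChartedSpace H M]

/-- A (pointwise) Riemannian metric: a symmetric, positive definite bilinear form
on each tangent space. -/
def IsRiemMetric (I : ModelWithCorners ℝ E H) {M : Type*} [TopologicalSpace M]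
    [ChartedSpace H M] (g : ∀ x : M, TangentSpace I x → TangentSpace I x → ℝ) : Prop :=
  ∀ x : M, (∀ v, IsLinearMap ℝ (g x v)) ∧ (∀ v w, g x v w = g x w v) ∧
    (∀ v : TangentSpace I x, v ≠ 0 → 0 < g x v v)

/-- The velocity vector of a curve. -/
def mvel (I : ModelWithCorners ℝ E H) {M : Type*} [TopologicalSpace M] [ChartedSpace H M]
    (γ : ℝ → M) (t : ℝ) : TangentSpace I (γ t) :=
  mfderiv 𝓘(ℝ, ℝ) I γ t ((1:ℝ) : TangentSpace 𝓘(ℝ, ℝ) t)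

/-- The length of a curve with respect to a metric `g`. -/
def curveLength (g : ∀ x : M, TangentSpace I x → TangentSpace I x → ℝ)
    (γ : ℝ → M) (a b : ℝ) : ℝ :=
  ∫ t in a..b, Real.sqrt (g (γ t) (mvel I γ t) (mvel I γ t))

/-- The Riemannian distance: infimum of lengths of smooth connecting curves. -/
def riemDist (g : ∀ x : M, TangentSpace I x → TangentSpace I x → ℝ) (x y : M) : ℝ :=
  sInf {L : ℝ | ∃ γ : ℝ → M, ContMDiff 𝓘(ℝ, ℝ) I 1 γ ∧ γ 0 = x ∧ γ 1 = y ∧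
    L = curveLength g γ 0 1}

/-- Completeness of `M` with respect to the distance induced by `g`. -/
def RiemComplete (g : ∀ x : M, TangentSpace I x → TangentSpace I x → ℝ) : Prop :=
  ∀ u : ℕ → M, (∀ ε > (0:ℝ), ∃ N, ∀ m ≥ N, ∀ n ≥ N, riemDist g (u m) (u n) < ε) →
    ∃ x : M, ∀ ε > (0:ℝ), ∃ N, ∀ n ≥ N, riemDist g (u n) x < ε

/-- A curve escapes to infinity: some sequence of parameters tending to `∞` is
mapped out of every compact set. -/
def IsEscaping (γ : ℝ → M) : Prop :=
  ∃ t : ℕ → ℝ, Tendsto t atTop atTop ∧ Tendsto (fun n => γ (t n)) atTop (cocompact M)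

/-- `γ` has unit `g`-speed on `[0,∞)`. -/
def UnitSpeed (g : ∀ x : M, TangentSpace I x → TangentSpace I x → ℝ) (γ : ℝ → M) : Prop :=
  ∀ s ∈ Ici (0:ℝ), g (γ s) (mvel I γ s) (mvel I γ s) = 1

/-- Euclidean 3-space. -/
abbrev E3 := EuclideanSpace ℝ (Fin 3)

/-- The punctured Euclidean space `ℝ³ ∖ {0}`. -/
def punctured : TopologicalSpace.Opens E3 := ⟨{x | x ≠ 0}, isOpen_compl_singleton⟩

/-- The flat Euclidean metric `δ = dr² + r² dΩ²` on `ℝ³ ∖ {0}`, i.e. the restriction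
of the Euclidean inner product. -/
def deltaFlat (x : punctured) (v w : TangentSpace 𝓘(ℝ, E3) x) : ℝ :=
  @inner ℝ E3 _ v w

/-- The metric of the theorem. -/
abbrev logMetric (c₁ c₂ : ℝ) (x : punctured) (v w : TangentSpace 𝓘(ℝ, E3) x) : ℝ :=
  (deltaFlat x v w / ‖(x : E3)‖ ^ 2) / (c₁ * |Real.log ‖(x : E3)‖| + c₂) ^ 2

/-- The speed, in terms of a curve in the ambient space. -/
def spd (c₁ c₂ : ℝ) (c : ℝ → E3) (t : ℝ) : ℝ :=
  ‖deriv c t‖ / (‖c t‖ * (c₁ * |Real.log ‖c t‖| + c₂))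

lemma mvel_eq (γ : ℝ → punctured) (hγ : ContMDiff 𝓘(ℝ, ℝ) 𝓘(ℝ, E3) 1 γ) (t : ℝ) :
    (mvel 𝓘(ℝ, E3) γ t : E3) = deriv (fun s => (γ s : E3)) t := by
  have h : MDifferentiableAt 𝓘(ℝ, ℝ) 𝓘(ℝ, E3) γ t :=
    hγ.mdifferentiable (by norm_num) t
  have h2 : (mfderiv 𝓘(ℝ, ℝ) 𝓘(ℝ, E3) γ t : ℝ →L[ℝ] E3)
      = fderiv ℝ (fun s => (γ s : E3)) t := by
    have h3 := h.mfderiv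
    refine h3.trans ?_
    simp only [writtenInExtChartAt, extChartAt, mfld_simps]
    rw [fderivWithin_univ]
    rfl
  rw [← fderiv_apply_one_eq_deriv, ← h2]
  rfl

lemma curveLength_eq (c₁ c₂ : ℝ) (hc₁ : 0 < c₁) (hc₂ : 0 < c₂)
    (γ : ℝ → punctured) (hγ : ContMDiff 𝓘(ℝ, ℝ) 𝓘(ℝ, E3) 1 γ) :
    curveLength (logMetric c₁ c₂) γ 0 1 = ∫ t in (0:ℝ)..1, spd c₁ c₂ (fun s => (γ s : E3)) t := by
  unfold curveLength
  congr 1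
  funext t
  have h1 : deltaFlat (γ t) (mvel 𝓘(ℝ, E3) γ t) (mvel 𝓘(ℝ, E3) γ t)
      = ‖deriv (fun s => (γ s : E3)) t‖ ^ 2 := by
    unfold deltaFlat
    rw [mvel_eq γ hγ t]
    exact real_inner_self_eq_norm_sq _
  unfold logMetric
  rw [h1, ← div_pow, ← div_pow, Real.sqrt_sq (by positivity), spd, div_div]

lemma contDiff_coe (γ : ℝ → punctured) :
    ContMDiff 𝓘(ℝ, ℝ) 𝓘(ℝ, E3) 1 γ ↔ ContDiff ℝ 1 (fun s => (γ s : E3)) := by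
  rw [← contMDiff_iff_contDiff]
  refine forall_congr' fun t => ?_
  exact (ChartedSpace.liftPropWithinAt_subtypeVal_comp_iff ..).symm

lemma spd_nonneg (c₁ c₂ : ℝ) (hc₁ : 0 < c₁) (hc₂ : 0 < c₂) (c : ℝ → E3) (t : ℝ) :
    0 ≤ spd c₁ c₂ c t := by unfold spd; positivity

lemma spd_cont (c₁ c₂ : ℝ) (hc₁ : 0 < c₁) (hc₂ : 0 < c₂) (c : ℝ → E3)
    (hc : ContDiff ℝ 1 c) (h0 : ∀ t, c t ≠ 0) : Continuous (spd c₁ c₂ c) := by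
  have h1 : Continuous (deriv c) := hc.continuous_deriv (by norm_num)
  have h2 : Continuous c := hc.continuous
  have h3 : Continuous (fun t => Real.log ‖c t‖) :=
    h2.norm.log (fun t => norm_ne_zero_iff.2 (h0 t))
  unfold spd
  refine Continuous.div (by fun_prop) (by fun_prop) ?_
  intro t
  have := norm_pos_iff.2 (h0 t)
  positivity

lemma length_bound {F : Type*} [NormedAddCommGroup F] [NormedSpace ℝ F] [CompleteSpace F]
    (f f' : ℝ → F) (σ : ℝ → ℝ) (C : ℝ) (hC : 0 ≤ C) (hf : ∀ t, HasDerivAt f (f' t) t)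
    (hf' : Continuous f') (hσ : Continuous σ) (hσ0 : ∀ t, 0 ≤ σ t) (t : ℝ) (ht : t ∈ Icc (0:ℝ) 1)
    (hb : ∀ t ∈ Icc (0:ℝ) 1, ‖f' t‖ ≤ C * σ t) :
    ‖f t - f 0‖ ≤ C * ∫ s in (0:ℝ)..1, σ s := by
  rw [← intervalIntegral.integral_eq_sub_of_hasDerivAt (fun x _ => hf x)
    (hf'.intervalIntegrable 0 t)]
  have h1 : ‖∫ s in (0:ℝ)..t, f' s‖ ≤ ∫ s in (0:ℝ)..t, C * σ s := by
    apply intervalIntegral.norm_integral_le_of_norm_le ht.1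
    · refine Filter.Eventually.of_forall fun s hs => hb s ⟨hs.1.le, hs.2.trans ht.2⟩
    · exact (continuous_const.mul hσ).intervalIntegrable _ _
  refine h1.trans ?_
  rw [intervalIntegral.integral_const_mul]
  refine mul_le_mul_of_nonneg_left ?_ hC
  exact intervalIntegral.integral_mono_interval le_rfl ht.1 ht.2
    (Filter.Eventually.of_forall fun s => hσ0 s) (hσ.intervalIntegrable _ _)

/-- The exhaustion function. -/
def qf (x : E3) : ℝ := Real.log (1 + (Real.log ‖x‖) ^ 2)

lemma q_bound (c₁ c₂ : ℝ) (hc₁ : 0 < c₁) (hc₂ : 0 < c₂) (c : ℝ → E3)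
    (hc : ContDiff ℝ 1 c) (h0 : ∀ t, c t ≠ 0) (t : ℝ) (ht : t ∈ Icc (0:ℝ) 1) :
    |qf (c t) - qf (c 0)| ≤ (2 * c₁ + c₂) * ∫ s in (0:ℝ)..1, spd c₁ c₂ c s := by
  have hcd : ∀ t, HasDerivAt c (deriv c t) t := fun t =>
    (hc.differentiable (by norm_num) t).hasDerivAt
  have hc' : Continuous (deriv c) := hc.continuous_deriv (by norm_num)
  have hcc : Continuous c := hc.continuous
  have hn : ∀ t, ‖c t‖ ≠ 0 := fun t => norm_ne_zero_iff.2 (h0 t)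
  have hl : Continuous (fun t => Real.log ‖c t‖) := hcc.norm.log hn
  have hL : ∀ t, HasDerivAt (fun t => Real.log ‖c t‖)
      (inner ℝ (c t) (deriv c t) / ‖c t‖ ^ 2) t := by
    intro t
    have h1 := ((hcd t).norm_sq.log (pow_ne_zero 2 (hn t))).div_const 2
    have h2 : (fun t => Real.log ‖c t‖) = fun t => Real.log (‖c t‖ ^ 2) / 2 := by
      funext s; rw [Real.log_pow]; push_cast; ring
    rw [h2]
    have h3 : (inner ℝ (c t) (deriv c t) / ‖c t‖ ^ 2 : ℝ)
        = 2 * inner ℝ (c t) (deriv c t) / ‖c t‖ ^ 2 / 2 := by ring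
    rw [h3]
    exact h1
  have hne : ∀ t, 1 + (Real.log ‖c t‖) ^ 2 ≠ 0 := fun t => by positivity
  have hq : ∀ t, HasDerivAt (fun t => qf (c t))
      (2 * Real.log ‖c t‖ * (inner ℝ (c t) (deriv c t) / ‖c t‖ ^ 2)
        / (1 + (Real.log ‖c t‖) ^ 2)) t := by
    intro t
    have := (((hL t).pow 2).const_add 1).log (hne t)
    have h3 : (2 * Real.log ‖c t‖ * (inner ℝ (c t) (deriv c t) / ‖c t‖ ^ 2)
        / (1 + (Real.log ‖c t‖) ^ 2) : ℝ) = ((2 : ℕ) : ℝ) * Real.log ‖c t‖ ^ (2 - 1) *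
        (inner ℝ (c t) (deriv c t) / ‖c t‖ ^ 2) / (1 + (Real.log ‖c t‖) ^ 2) := by
      norm_num
    rw [h3]
    exact this
  refine length_bound (fun t => qf (c t)) _ (spd c₁ c₂ c) (2 * c₁ + c₂) (by positivity) hq ?_
    (spd_cont c₁ c₂ hc₁ hc₂ c hc h0) (spd_nonneg c₁ c₂ hc₁ hc₂ c) t ht ?_
  · refine Continuous.div ?_ (by fun_prop) hne
    refine Continuous.mul (by fun_prop) ?_
    exact Continuous.div (by fun_prop) (by fun_prop) (fun t => pow_ne_zero 2 (hn t))
  · intro s _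
    have hp : 0 < ‖c s‖ := norm_pos_iff.2 (h0 s)
    have hi := abs_real_inner_le_norm (c s) (deriv c s)
    unfold spd
    set l := Real.log ‖c s‖
    set n := ‖c s‖
    set d := ‖deriv c s‖
    have hd : 0 ≤ d := norm_nonneg _
    rw [Real.norm_eq_abs, abs_div, abs_mul, abs_mul, abs_div, abs_of_pos (show (0:ℝ) < 2 by norm_num),
      abs_of_pos (show 0 < 1 + l ^ 2 by positivity), abs_of_pos (show 0 < n ^ 2 by positivity)]
    have hA : |inner ℝ (c s) (deriv c s)| / n ^ 2 ≤ d / n := by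
      rw [div_le_div_iff₀ (by positivity) hp]; nlinarith
    have hB : 2 * |l| / (1 + l ^ 2) ≤ (2 * c₁ + c₂) / (c₁ * |l| + c₂) := by
      rw [div_le_div_iff₀ (by positivity) (by positivity)]
      have := sq_abs l
      have h3 := abs_nonneg l
      nlinarith [mul_nonneg hc₂.le (sq_nonneg (|l| - 1))]
    calc 2 * |l| * (|inner ℝ (c s) (deriv c s)| / n ^ 2) / (1 + l ^ 2)
        = (2 * |l| / (1 + l ^ 2)) * (|inner ℝ (c s) (deriv c s)| / n ^ 2) := by ring
      _ ≤ (2 * c₁ + c₂) / (c₁ * |l| + c₂) * (d / n) := by gcongr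
      _ = _ := by field_simp

/-- Bound on `|log ‖x‖|` from a bound on `qf`. -/
lemma log_le_of_q (x : E3) (K : ℝ) (h : qf x ≤ K) : |Real.log ‖x‖| ≤ Real.exp K := by
  have h1 : 1 + (Real.log ‖x‖) ^ 2 ≤ Real.exp K := by
    rw [← Real.exp_log (show 0 < 1 + (Real.log ‖x‖) ^ 2 by positivity)]
    exact Real.exp_le_exp.2 h
  have := sq_abs (Real.log ‖x‖)
  nlinarith [sq_nonneg (|Real.log ‖x‖| - 1)]

lemma dist_bound (c₁ c₂ : ℝ) (hc₁ : 0 < c₁) (hc₂ : 0 < c₂) (K : ℝ) :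
    ∃ D > 0, ∀ c : ℝ → E3, ContDiff ℝ 1 c → (∀ t, c t ≠ 0) → qf (c 0) ≤ K →
      (∫ s in (0:ℝ)..1, spd c₁ c₂ c s) ≤ 1 →
      ‖c 1 - c 0‖ ≤ D * ∫ s in (0:ℝ)..1, spd c₁ c₂ c s := by
  set R := Real.exp (K + (2 * c₁ + c₂)) with hR
  refine ⟨Real.exp R * (c₁ * R + c₂), by positivity, ?_⟩
  intro c hc h0 hK hL
  refine length_bound c (deriv c) (spd c₁ c₂ c) _ (by positivity)
    (fun t => (hc.differentiable (by norm_num) t).hasDerivAt)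
    (hc.continuous_deriv (by norm_num)) (spd_cont c₁ c₂ hc₁ hc₂ c hc h0)
    (spd_nonneg c₁ c₂ hc₁ hc₂ c) 1 (by simp) ?_
  intro t ht
  have h1 := (abs_le.1 (q_bound c₁ c₂ hc₁ hc₂ c hc h0 t ht)).2
  have h2 : qf (c t) ≤ K + (2 * c₁ + c₂) := by nlinarith
  have h3 := log_le_of_q _ _ h2
  rw [← hR] at h3
  have hp : 0 < ‖c t‖ := norm_pos_iff.2 (h0 t)
  have h4 : ‖c t‖ ≤ Real.exp R := by
    rw [← Real.log_le_iff_le_exp hp]; exact (le_abs_self _).trans h3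
  have h5 : ‖c t‖ * (c₁ * |Real.log ‖c t‖| + c₂) ≤ Real.exp R * (c₁ * R + c₂) := by gcongr
  have h6 := spd_nonneg c₁ c₂ hc₁ hc₂ c t
  calc ‖deriv c t‖ = ‖c t‖ * (c₁ * |Real.log ‖c t‖| + c₂) * spd c₁ c₂ c t := by
        unfold spd; field_simp
    _ ≤ _ := by gcongr

lemma exists_curve (x y : E3) (hx : x ≠ 0) (hy : y ≠ 0) :
    ∃ c : ℝ → E3, ContDiff ℝ 1 c ∧ (∀ t, c t ≠ 0) ∧ c 0 = x ∧ c 1 = y := by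
  obtain ⟨v, hv, hvx, hvy⟩ : ∃ v : E3, v ≠ 0 ∧ inner ℝ x v = 0 ∧ inner ℝ y v = 0 := by
    have hfin : Module.finrank ℝ (Submodule.span ℝ ({x, y} : Set E3)) ≤ 2 := by
      classical
      have := finrank_span_finset_le_card (R := ℝ) ({x, y} : Finset E3)
      simp only [Finset.coe_insert, Finset.coe_singleton] at this
      exact this.trans Finset.card_le_two
    have hsum := Submodule.finrank_add_finrank_orthogonal (Submodule.span ℝ ({x, y} : Set E3))
    have h3 : Module.finrank ℝ E3 = 3 := by simp
    have hne : (Submodule.span ℝ ({x, y} : Set E3))ᗮ ≠ ⊥ := by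
      intro h
      rw [h, finrank_bot] at hsum
      omega
    obtain ⟨v, hv, hv0⟩ := Submodule.exists_mem_ne_zero_of_ne_bot hne
    rw [Submodule.mem_orthogonal] at hv
    exact ⟨v, hv0, hv x (Submodule.subset_span (by simp)),
      hv y (Submodule.subset_span (by simp))⟩
  refine ⟨fun t => (1 - t) • x + t • y + (t * (1 - t)) • v, by fun_prop, ?_, by simp, by simp⟩
  intro t h
  have h1 : inner ℝ ((1 - t) • x + t • y + (t * (1 - t)) • v) v = 0 := by
    simp only at h; rw [h, inner_zero_left]
  rw [inner_add_left, inner_add_left, real_inner_smul_left, real_inner_smul_left,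
    real_inner_smul_left, hvx, hvy, mul_zero, mul_zero, zero_add, zero_add,
    real_inner_self_eq_norm_sq] at h1
  have h2 : t * (1 - t) = 0 := by
    rcases mul_eq_zero.1 h1 with h | h
    · exact h
    · exact absurd h (by positivity)
  rcases mul_eq_zero.1 h2 with h' | h'
  · subst h'; simp at h; exact hx h
  · have : t = 1 := by linarith
    subst this; simp at h; exact hy h

/-- A distance less than `ε` is witnessed by a curve. -/
lemma exists_short (c₁ c₂ : ℝ) (hc₁ : 0 < c₁) (hc₂ : 0 < c₂) (x y : punctured) (ε : ℝ)
    (h : riemDist (logMetric c₁ c₂) x y < ε) :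
    ∃ c : ℝ → E3, ContDiff ℝ 1 c ∧ (∀ t, c t ≠ 0) ∧ c 0 = x ∧ c 1 = y ∧
      (∫ s in (0:ℝ)..1, spd c₁ c₂ c s) < ε := by
  unfold riemDist at h
  obtain ⟨L, ⟨γ, hγ, h0, h1, rfl⟩, hL⟩ := exists_lt_of_csInf_lt (by
    obtain ⟨c, hc, hc0, h0, h1⟩ := exists_curve x y x.2 y.2
    exact ⟨_, fun t => ⟨c t, hc0 t⟩, (contDiff_coe _).2 hc, Subtype.ext h0, Subtype.ext h1, rfl⟩) h
  refine ⟨fun s => (γ s : E3), (contDiff_coe _).1 hγ, fun t => (γ t).2, by simp [h0],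
    by simp [h1], ?_⟩
  rw [← curveLength_eq c₁ c₂ hc₁ hc₂ γ hγ]
  exact hL

lemma riemDist_le (c₁ c₂ : ℝ) (hc₁ : 0 < c₁) (hc₂ : 0 < c₂) (x y : punctured)
    (c : ℝ → E3) (hc : ContDiff ℝ 1 c) (hc0 : ∀ t, c t ≠ 0) (h0 : c 0 = x) (h1 : c 1 = y) :
    riemDist (logMetric c₁ c₂) x y ≤ ∫ s in (0:ℝ)..1, spd c₁ c₂ c s := by
  unfold riemDist
  refine csInf_le ⟨0, ?_⟩ ?_
  · rintro L ⟨γ, hγ, -, -, rfl⟩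
    rw [curveLength_eq c₁ c₂ hc₁ hc₂ γ hγ]
    exact intervalIntegral.integral_nonneg (by norm_num)
      (fun t _ => spd_nonneg c₁ c₂ hc₁ hc₂ _ t)
  · have hγ : ContMDiff 𝓘(ℝ, ℝ) 𝓘(ℝ, E3) 1 (fun t => (⟨c t, hc0 t⟩ : punctured)) :=
      (contDiff_coe _).2 hc
    exact ⟨fun t => ⟨c t, hc0 t⟩, hγ, Subtype.ext h0, Subtype.ext h1,
      (curveLength_eq c₁ c₂ hc₁ hc₂ _ hγ).symm⟩

/-- Local upper bound of the distance by the Euclidean one. -/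
lemma upper_bound (c₁ c₂ : ℝ) (hc₁ : 0 < c₁) (hc₂ : 0 < c₂) (x : punctured) :
    ∃ B > 0, ∀ y : punctured, ‖(y : E3) - x‖ ≤ ‖(x : E3)‖ / 2 →
      riemDist (logMetric c₁ c₂) y x ≤ B * ‖(y : E3) - x‖ := by
  have hs : ContDiff ℝ 1 Real.smoothTransition := Real.smoothTransition.contDiff (n := 1)
  have hs' : Continuous (deriv Real.smoothTransition) := hs.continuous_deriv (by norm_num)
  obtain ⟨A, hA⟩ := (isCompact_Icc (a := (0:ℝ)) (b := 1)).exists_bound_of_continuousOn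
    hs'.continuousOn
  have hA0 : 0 ≤ A := (norm_nonneg _).trans (hA 0 (by simp))
  have hx : 0 < ‖(x : E3)‖ := norm_pos_iff.2 x.2
  refine ⟨(A + 1) / (‖(x : E3)‖ / 2 * c₂), by positivity, ?_⟩
  intro y hy
  set c : ℝ → E3 := fun t => (y : E3) + Real.smoothTransition t • ((x : E3) - y) with hcdef
  have hc : ContDiff ℝ 1 c := by fun_prop
  have hlow : ∀ t, ‖(x : E3)‖ / 2 ≤ ‖c t‖ := by
    intro t
    have e : (x : E3) - c t = (1 - Real.smoothTransition t) • ((x : E3) - y) := by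
      simp only [hcdef]; module
    have h1 : ‖(x : E3) - c t‖ ≤ ‖(y : E3) - x‖ := by
      rw [e, norm_smul, norm_sub_rev (x : E3) y, Real.norm_eq_abs, abs_of_nonneg
        (sub_nonneg.2 (Real.smoothTransition.le_one t))]
      exact mul_le_of_le_one_left (norm_nonneg _)
        (by linarith [Real.smoothTransition.nonneg t])
    have h2 := norm_sub_norm_le (x : E3) (c t)
    linarith
  have hc0 : ∀ t, c t ≠ 0 := fun t => norm_pos_iff.1 ((half_pos hx).trans_le (hlow t))
  refine (riemDist_le c₁ c₂ hc₁ hc₂ y x c hc hc0 (by simp [hcdef]) (by simp [hcdef])).trans ?_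
  have hb : ∀ t ∈ Icc (0:ℝ) 1,
      spd c₁ c₂ c t ≤ (A + 1) / (‖(x : E3)‖ / 2 * c₂) * ‖(y : E3) - x‖ := by
    intro t ht
    have hd : deriv c t = deriv Real.smoothTransition t • ((x : E3) - y) := by
      have := ((hs.differentiable (by norm_num) t).hasDerivAt.smul_const ((x : E3) - y)).const_add
        (y : E3)
      exact this.deriv
    unfold spd
    rw [hd, norm_smul, norm_sub_rev (x : E3) y, div_mul_eq_mul_div]
    have h1 := hA t ht
    have h2 := hlow t
    have h3 : c₂ ≤ c₁ * |Real.log ‖c t‖| + c₂ := by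
      have : 0 ≤ c₁ * |Real.log ‖c t‖| := by positivity
      linarith
    gcongr
    linarith
  have := intervalIntegral.integral_mono_on (μ := volume) (zero_le_one (α := ℝ))
    ((spd_cont c₁ c₂ hc₁ hc₂ c hc hc0).intervalIntegrable 0 1)
    (intervalIntegrable_const (c := (A + 1) / (‖(x : E3)‖ / 2 * c₂) * ‖(y : E3) - x‖)) hb
  simpa using this

/-- On `ℝ³ ∖ {0}`, the metric `(dr²/r² + dΩ²)/(c₁|ln r| + c₂)²` is complete. -/
theorem punctured_log_conformal_complete (c₁ c₂ : ℝ) (hc₁ : 0 < c₁) (hc₂ : 0 < c₂) :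
    RiemComplete (fun x v w =>
      (deltaFlat x v w / ‖(x : E3)‖ ^ 2) / (c₁ * |Real.log ‖(x : E3)‖| + c₂) ^ 2) := by
  change RiemComplete (logMetric c₁ c₂)
  intro u hu
  obtain ⟨N₀, hN₀⟩ := hu 1 one_pos
  set K := qf (u N₀ : E3) + (2 * c₁ + c₂) with hK
  have hq : ∀ n ≥ N₀, qf (u n : E3) ≤ K := by
    intro n hn
    obtain ⟨c, hc, hc0, h0, h1, hL⟩ := exists_short c₁ c₂ hc₁ hc₂ _ _ _ (hN₀ N₀ le_rfl n hn)
    have h2 := (abs_le.1 (q_bound c₁ c₂ hc₁ hc₂ c hc hc0 1 (by simp))).2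
    rw [h0, h1] at h2
    nlinarith
  obtain ⟨D, hD, hdist⟩ := dist_bound c₁ c₂ hc₁ hc₂ K
  have hcau : CauchySeq (fun n => (u n : E3)) := by
    rw [Metric.cauchySeq_iff]
    intro ε hε
    obtain ⟨N, hN⟩ := hu (min 1 (ε / D)) (lt_min one_pos (div_pos hε hD))
    refine ⟨max N N₀, fun m hm n hn => ?_⟩
    obtain ⟨c, hc, hc0, h0, h1, hL⟩ := exists_short c₁ c₂ hc₁ hc₂ _ _ _
      (hN m ((le_max_left _ _).trans hm) n ((le_max_left _ _).trans hn))
    have h2 := hdist c hc hc0 (by rw [h0]; exact hq m ((le_max_right _ _).trans hm))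
      (hL.le.trans (min_le_left _ _))
    rw [h0, h1] at h2
    rw [dist_comm, dist_eq_norm]
    refine h2.trans_lt ?_
    have h3 := hL.trans_le (min_le_right _ _)
    rw [lt_div_iff₀ hD] at h3
    linarith
  obtain ⟨x, hx⟩ := cauchySeq_tendsto_of_complete hcau
  have hx0 : x ≠ 0 := by
    have h1 : Real.exp (-Real.exp K) ≤ ‖x‖ := by
      refine ge_of_tendsto hx.norm ?_
      filter_upwards [eventually_ge_atTop N₀] with n hn
      rw [← Real.le_log_iff_exp_le (norm_pos_iff.2 (u n).2)]
      exact (abs_le.1 (log_le_of_q _ _ (hq n hn))).1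
    exact norm_pos_iff.1 ((Real.exp_pos _).trans_le h1)
  obtain ⟨B, hB, hup⟩ := upper_bound c₁ c₂ hc₁ hc₂ ⟨x, hx0⟩
  refine ⟨⟨x, hx0⟩, fun ε hε => ?_⟩
  have hxp : 0 < ‖x‖ := norm_pos_iff.2 hx0
  obtain ⟨N, hN⟩ := (Metric.tendsto_atTop.1 hx) (min (‖x‖ / 2) (ε / B))
    (lt_min (half_pos hxp) (div_pos hε hB))
  refine ⟨N, fun n hn => ?_⟩
  have h1 := hN n hn
  rw [dist_eq_norm] at h1
  refine (hup (u n) (h1.le.trans (min_le_left _ _))).trans_lt ?_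
  have h3 := h1.trans_le (min_le_right _ _)
  rw [lt_div_iff₀ hB] at h3
  simp only
  linarith

end
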